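/- For every integer l ≥ L+1 and every real ν with |ν| > 1, p_l^m(ν) Λ^m(ν) = g_l^m(ν) − ϖ ν g^m(ν,ν) q_l^m(ν), where g^m(ν,ν) denotes the value of the function μ ↦ g^m(ν,μ) at μ = ν. -/

import Mathlib

open MeasureTheory Filter

/-- Legendre polynomial via Rodrigues' formula. -/
noncomputable def legendreP (l : ℕ) (x : ℝ) : ℝ :=
  (1 / (2 ^ l * (Nat.factorial l : ℝ))) *
    iteratedDeriv l (fun y : ℝ => (y ^ 2 - 1) ^ l) x

/-- `p_l^m(μ) = √((l−m)!/(l+m)!) (d/dμ)^m P_l(μ)`; it vanishes for `l < m`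
(in particular the convention `p_{m−1}^m = 0` holds). -/
noncomputable def pml (m l : ℕ) (μ : ℝ) : ℝ :=
  Real.sqrt ((Nat.factorial (l - m) : ℝ) / (Nat.factorial (l + m) : ℝ)) *
    iteratedDeriv m (legendreP l) μ

/-- `q_l^m(w) = (1/2) ∫_{−1}^{1} p_l^m(μ)/(w−μ) (1−μ²)^m dμ`. -/
noncomputable def qml (m l : ℕ) (w : ℝ) : ℝ :=
  (1 / 2) * ∫ μ in (-1 : ℝ)..1, pml m l μ / (w - μ) * (1 - μ ^ 2) ^ m

/-- `h_l = 2l+1 − ϖ β_l` for `l ≤ L`, and `h_l = 2l+1` for `l > L`. -/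
noncomputable def hcoef (ϖ : ℝ) (β : ℕ → ℝ) (L l : ℕ) : ℝ :=
  if l ≤ L then 2 * l + 1 - ϖ * β l else 2 * l + 1

/-- Auxiliary recursion: `chandraAux ϖ β L m ν n = g_{m+n}^m(ν)`, built from the
initial value `g_m^m(ν) = √((2m)!)/(2^m m!)`, the convention `g_{m−1}^m = 0`, and the
three-term recurrence `ν h_l g_l^m = √((l+1)²−m²) g_{l+1}^m + √(l²−m²) g_{l−1}^m`. -/
noncomputable def chandraAux (ϖ : ℝ) (β : ℕ → ℝ) (L m : ℕ) (ν : ℝ) : ℕ → ℝ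
  | 0 => Real.sqrt (Nat.factorial (2 * m)) / (2 ^ m * Nat.factorial m)
  | 1 => ν * hcoef ϖ β L m *
      (Real.sqrt (Nat.factorial (2 * m)) / (2 ^ m * Nat.factorial m)) /
      Real.sqrt (((m : ℝ) + 1) ^ 2 - (m : ℝ) ^ 2)
  | n + 2 =>
      (ν * hcoef ϖ β L (m + n + 1) * chandraAux ϖ β L m ν (n + 1) -
          Real.sqrt (((m + n + 1 : ℕ) : ℝ) ^ 2 - (m : ℝ) ^ 2) * chandraAux ϖ β L m ν n) /
        Real.sqrt (((m + n + 2 : ℕ) : ℝ) ^ 2 - (m : ℝ) ^ 2)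

/-- The normalized Chandrasekhar polynomial `g_l^m(ν)` (with value `0` for `l < m`). -/
noncomputable def gml (ϖ : ℝ) (β : ℕ → ℝ) (L m l : ℕ) (ν : ℝ) : ℝ :=
  if l < m then 0 else chandraAux ϖ β L m ν (l - m)

/-- `g^m(ν,μ) = Σ_{l=m}^{L} β_l p_l^m(μ) g_l^m(ν)`. -/
noncomputable def gfun (ϖ : ℝ) (β : ℕ → ℝ) (L m : ℕ) (ν μ : ℝ) : ℝ :=
  ∑ l ∈ Finset.Icc m L, β l * pml m l μ * gml ϖ β L m l ν

/-- `Λ^m(w) = 1 − (ϖ w/2) ∫_{−1}^{1} g^m(w,μ)/(w−μ) (1−μ²)^m dμ`. -/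
noncomputable def Lam (ϖ : ℝ) (β : ℕ → ℝ) (L m : ℕ) (w : ℝ) : ℝ :=
  1 - ϖ * w / 2 * ∫ μ in (-1 : ℝ)..1, gfun ϖ β L m w μ / (w - μ) * (1 - μ ^ 2) ^ m

/-- The off-diagonal entry `b_l = √((l²−m²)/(h_l h_{l−1}))`. -/
noncomputable def bcoef (ϖ : ℝ) (β : ℕ → ℝ) (L m l : ℕ) : ℝ :=
  Real.sqrt (((l : ℝ) ^ 2 - (m : ℝ) ^ 2) / (hcoef ϖ β L l * hcoef ϖ β L (l - 1)))

/-- The symmetric tridiagonal matrix `B(m)` with rows/columns indexed by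
`l ∈ {m, …, l_B}` (here `l = m + i` for `i : Fin (l_B − m + 1)`), zero diagonal and
off-diagonal entries `B(m)_{l,l−1} = B(m)_{l−1,l} = b_l`. -/
noncomputable def Bmat (ϖ : ℝ) (β : ℕ → ℝ) (L m lB : ℕ) :
    Matrix (Fin (lB - m + 1)) (Fin (lB - m + 1)) ℝ :=
  fun i j =>
    if (i : ℕ) + 1 = (j : ℕ) then bcoef ϖ β L m (m + j)
    else if (j : ℕ) + 1 = (i : ℕ) then bcoef ϖ β L m (m + i)
    else 0


open Polynomial in
/-- The `m`-th derivative of the Legendre polynomial `P_l`, as a polynomial. -/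
noncomputable def legendreDeriv (m l : ℕ) : ℝ[X] :=
  C (1 / (2 ^ l * (Nat.factorial l : ℝ))) * derivative^[l + m] ((X ^ 2 - 1) ^ l)

section PolynomialIdentities

open Polynomial

theorem iterate_derivative_succ_X_mul (k : ℕ) (f : ℝ[X]) :
    derivative^[k + 1] (X * f) =
      X * derivative^[k + 1] f + C ((k : ℝ) + 1) * derivative^[k] f := by
  induction k generalizing f with
  | zero => simp [derivative_mul]; ring
  | succ k ih =>
    rw [Function.iterate_succ_apply', ih f]
    simp only [derivative_add, derivative_mul, derivative_X, derivative_C, zero_mul, zero_add,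
      ← Function.iterate_succ_apply' (f := (derivative : ℝ[X] → ℝ[X]))]
    push_cast
    simp only [map_add, map_one]
    ring

theorem derivative_X_sq_sub_one_pow (n : ℕ) :
    derivative ((X ^ 2 - 1 : ℝ[X]) ^ (n + 1)) = C (2 * ((n : ℝ) + 1)) * (X * (X ^ 2 - 1) ^ n) := by
  rw [derivative_pow_succ]
  simp only [derivative_sub, derivative_X_pow, derivative_one, map_mul, map_add, map_one]
  simp
  ring

theorem derivative_derivative_X_sq_sub_one_pow (n : ℕ) :
    derivative (derivative ((X ^ 2 - 1 : ℝ[X]) ^ (n + 2))) =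
      C (2 * ((n : ℝ) + 2) * (2 * n + 3)) * (X ^ 2 - 1) ^ (n + 1) +
        C (4 * ((n : ℝ) + 1) * (n + 2)) * (X ^ 2 - 1) ^ n := by
  rw [derivative_X_sq_sub_one_pow (n + 1), derivative_C_mul, derivative_mul,
    derivative_X_sq_sub_one_pow n]
  push_cast
  simp only [map_add, map_mul, map_one, map_ofNat, map_natCast, derivative_X]
  ring

theorem iteratedDeriv_legendreP (m l : ℕ) (x : ℝ) :
    iteratedDeriv m (legendreP l) x = (legendreDeriv m l).eval x := by
  have key : ∀ (k : ℕ) (f : ℝ[X]),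
      iteratedDeriv k (fun y => f.eval y) = fun y => (derivative^[k] f).eval y := by
    intro k
    induction k with
    | zero => intro f; simp
    | succ k ih =>
      intro f
      rw [iteratedDeriv_succ, ih, Function.iterate_succ_apply']
      funext y
      exact Polynomial.deriv _
  have h : legendreP l = fun y =>
      (C (1 / (2 ^ l * (Nat.factorial l : ℝ))) * derivative^[l] ((X ^ 2 - 1) ^ l)).eval y := by
    funext y
    have := congrFun (key l ((X ^ 2 - 1) ^ l)) y
    simp only [eval_pow, eval_sub, eval_X, eval_one] at this
    rw [legendreP, this, eval_mul, eval_C]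
  rw [h, key, iterate_derivative_C_mul, ← Function.iterate_add_apply, legendreDeriv, add_comm l m]

/-- The three-term recurrence for associated Legendre polynomials. -/
theorem legendreDeriv_recurrence (m n : ℕ) :
    C ((n : ℝ) + 2 - m) * legendreDeriv m (n + 2) =
      C (2 * (n : ℝ) + 3) * (X * legendreDeriv m (n + 1)) -
        C ((n : ℝ) + 1 + m) * legendreDeriv m n := by
  set J := C (1 / (2 ^ (n + 1) * ((n + 1).factorial : ℝ))) *
    derivative^[n + m] ((X ^ 2 - 1 : ℝ[X]) ^ (n + 1)) with hJ
  have e2 : (1 / (2 ^ (n + 2) * ((n + 2).factorial : ℝ))) * (2 * ((n : ℝ) + 2)) =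
      1 / (2 ^ (n + 1) * ((n + 1).factorial : ℝ)) := by
    rw [Nat.factorial_succ (n + 1)]; push_cast
    have : ((n + 1).factorial : ℝ) ≠ 0 := by positivity
    field_simp
    ring
  have e3 : (1 / (2 ^ (n + 2) * ((n + 2).factorial : ℝ))) * (4 * ((n : ℝ) + 1) * (n + 2)) =
      1 / (2 ^ n * (n.factorial : ℝ)) := by
    rw [Nat.factorial_succ (n + 1), Nat.factorial_succ n]; push_cast
    have : (n.factorial : ℝ) ≠ 0 := by positivity
    field_simp
    ring
  have h1 : legendreDeriv m (n + 2) =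
      X * legendreDeriv m (n + 1) + C ((n : ℝ) + 1 + m) * J := by
    rw [legendreDeriv, show n + 2 + m = (n + m + 1) + 1 by ring, Function.iterate_succ_apply,
      derivative_X_sq_sub_one_pow (n + 1), iterate_derivative_C_mul,
      iterate_derivative_succ_X_mul, ← mul_assoc, ← C_mul, hJ, legendreDeriv,
      show n + 1 + m = n + m + 1 by ring]
    push_cast
    rw [show (n : ℝ) + 1 + 1 = n + 2 by ring, e2]
    simp only [map_add, map_one]
    ring
  have h2 : legendreDeriv m (n + 2) = C (2 * (n : ℝ) + 3) * J + legendreDeriv m n := by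
    rw [legendreDeriv, show n + 2 + m = (n + m) + 1 + 1 by ring, Function.iterate_succ_apply,
      Function.iterate_succ_apply, derivative_derivative_X_sq_sub_one_pow, iterate_map_add,
      iterate_derivative_C_mul, iterate_derivative_C_mul, hJ, legendreDeriv, mul_add, ← e2, ← e3]
    simp only [map_mul]
    ring
  have hC : C (2 * (n : ℝ) + 3) = C ((n : ℝ) + 2 - m) + C ((n : ℝ) + 1 + m) := by
    rw [← C_add]; congr 1; ring
  calc C ((n : ℝ) + 2 - m) * legendreDeriv m (n + 2)
      = C (2 * (n : ℝ) + 3) * legendreDeriv m (n + 2) -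
          C ((n : ℝ) + 1 + m) * legendreDeriv m (n + 2) := by rw [hC]; ring
    _ = C (2 * (n : ℝ) + 3) * (X * legendreDeriv m (n + 1) + C ((n : ℝ) + 1 + m) * J) -
          C ((n : ℝ) + 1 + m) * (C (2 * (n : ℝ) + 3) * J + legendreDeriv m n) := by
        rw [← h1, ← h2]
    _ = _ := by ring

theorem iterate_derivative_X_sq_sub_one_pow (n : ℕ) :
    derivative^[2 * n] ((X ^ 2 - 1 : ℝ[X]) ^ n) = C ((2 * n).factorial : ℝ) := by
  induction n with
  | zero => simp
  | succ n ih =>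
    rw [show 2 * (n + 1) = (2 * n + 1) + 1 by ring, Function.iterate_succ_apply,
      derivative_X_sq_sub_one_pow, iterate_derivative_C_mul, iterate_derivative_succ_X_mul,
      Function.iterate_succ_apply', ih, derivative_C, Nat.factorial_succ, Nat.factorial_succ]
    push_cast
    simp only [map_add, map_mul, map_one, map_ofNat, map_natCast]
    ring

theorem legendreDeriv_self (m : ℕ) :
    legendreDeriv m m = C (((2 * m).factorial : ℝ) / (2 ^ m * (m.factorial : ℝ))) := by
  rw [legendreDeriv, ← two_mul, iterate_derivative_X_sq_sub_one_pow, ← C_mul]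
  congr 1
  ring

theorem legendreDeriv_succ_self (m : ℕ) :
    legendreDeriv m (m + 1) = C (2 * (m : ℝ) + 1) * (X * legendreDeriv m m) := by
  cases m with
  | zero =>
    simp only [legendreDeriv]
    simp
    rw [← mul_assoc, one_add_one_eq_two, ← C_ofNat, ← C_mul]
    norm_num
  | succ k =>
    have h0 : legendreDeriv (k + 1) k = 0 := by
      rw [legendreDeriv, show k + (k + 1) = 2 * k + 1 by ring, Function.iterate_succ_apply',
        iterate_derivative_X_sq_sub_one_pow, derivative_C, mul_zero]
    have h := legendreDeriv_recurrence (k + 1) k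
    rw [h0, mul_zero, sub_zero] at h
    push_cast at h ⊢
    rw [show (k : ℝ) + 2 - (k + 1) = 1 by ring, C_1, one_mul] at h
    rw [h]
    congr 2
    ring

/-- The differential equation for `(d/dx)^m P_l`, in self-adjoint form. -/
theorem derivative_one_sub_X_sq_pow_mul_legendreDeriv (m l : ℕ) :
    derivative ((1 - X ^ 2) ^ (m + 1) * legendreDeriv (m + 1) l) =
      C (((m : ℝ) - l) * (l + m + 1)) * ((1 - X ^ 2) ^ m * legendreDeriv m l) := by
  set u : ℝ[X] := (X ^ 2 - 1) ^ l with hu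
  set k := l + m with hk
  have hode : X * (X * derivative u) - derivative u = C (2 * (l : ℝ)) * (X * u) := by
    rw [hu]
    cases l with
    | zero => simp
    | succ l =>
      rw [derivative_X_sq_sub_one_pow]
      push_cast
      ring
  have h := congrArg (fun f => derivative^[k + 1] f) hode
  simp only [iterate_derivative_sub, iterate_derivative_C_mul, iterate_derivative_succ_X_mul] at h
  have hX : C ((k : ℝ) + 1) * derivative^[k] (X * derivative u) =
      C ((k : ℝ) + 1) * (X * derivative^[k + 1] u + C (k : ℝ) * derivative^[k] u) := by
    congr 1
    cases k with
    | zero => simp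
    | succ j =>
      rw [iterate_derivative_succ_X_mul, ← Function.iterate_succ_apply,
        ← Function.iterate_succ_apply]
      push_cast
      rfl
  rw [hX] at h
  simp only [← Function.iterate_succ_apply] at h
  have e0 : legendreDeriv m l = C (1 / (2 ^ l * (Nat.factorial l : ℝ))) * derivative^[k] u := rfl
  have e1 : legendreDeriv (m + 1) l =
    C (1 / (2 ^ l * (Nat.factorial l : ℝ))) * derivative^[k + 1] u := rfl
  have e2 : derivative (legendreDeriv (m + 1) l) =
      C (1 / (2 ^ l * (Nat.factorial l : ℝ))) * derivative^[k + 2] u := by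
    rw [e1, derivative_C_mul, ← Function.iterate_succ_apply' (f := (derivative : ℝ[X] → ℝ[X]))]
  rw [derivative_mul, e2, e1, e0, derivative_pow_succ]
  simp only [derivative_sub, derivative_one, derivative_X_pow]
  have hkc : (k : ℝ) = l + m := by rw [hk]; push_cast; ring
  rw [hkc] at h
  simp only [map_add, map_mul, map_sub, map_one, map_ofNat, map_natCast, Nat.succ_eq_add_one] at h ⊢
  generalize C (1 / (2 ^ l * (Nat.factorial l : ℝ))) = r
  norm_num at h ⊢
  linear_combination (-r * (1 - X ^ 2) ^ m) * h

end PolynomialIdentities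

open Polynomial in
theorem integral_derivative_eval (f : ℝ[X]) :
    ∫ x in (-1 : ℝ)..1, (derivative f).eval x = f.eval 1 - f.eval (-1) :=
  intervalIntegral.integral_eq_sub_of_hasDerivAt (fun x _ => f.hasDerivAt x)
    ((derivative f).continuous.intervalIntegrable _ _)

open Polynomial in
theorem integral_legendreDeriv_eq_zero {m l : ℕ} (h : m < l) :
    ∫ x in (-1 : ℝ)..1, (legendreDeriv m l).eval x * (1 - x ^ 2) ^ m = 0 := by
  have h1 := integral_derivative_eval ((1 - X ^ 2) ^ (m + 1) * legendreDeriv (m + 1) l)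
  rw [derivative_one_sub_X_sq_pow_mul_legendreDeriv] at h1
  simp only [eval_mul, eval_C, eval_pow, eval_sub, eval_one, eval_X,
    intervalIntegral.integral_const_mul] at h1
  norm_num at h1
  have hml : (m : ℝ) < l := by exact_mod_cast h
  rcases h1 with (h1 | h1) | h1
  · linarith
  · have : (0 : ℝ) < l + m + 1 := by positivity
    linarith
  · rw [← h1]
    congr 1
    funext x
    ring

open Polynomial in
theorem integral_one_sub_sq_pow (m : ℕ) :
    ∫ x in (-1 : ℝ)..1, (1 - x ^ 2) ^ m =
      2 * 4 ^ m * (m.factorial : ℝ) ^ 2 / ((2 * m + 1).factorial : ℝ) := by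
  induction m with
  | zero => norm_num
  | succ m ih =>
    have h1 := integral_derivative_eval (X * (1 - X ^ 2) ^ (m + 1))
    have h2 : derivative (X * (1 - X ^ 2 : ℝ[X]) ^ (m + 1)) =
        C (2 * (m : ℝ) + 3) * (1 - X ^ 2) ^ (m + 1) - C (2 * (m : ℝ) + 2) * (1 - X ^ 2) ^ m := by
      rw [derivative_mul, derivative_pow_succ]
      simp only [derivative_sub, derivative_one, derivative_X_pow, derivative_X, map_add, map_mul,
        map_ofNat, map_natCast, map_one]
      norm_num
      ring
    rw [h2] at h1
    simp only [eval_mul, eval_C, eval_pow, eval_sub, eval_one, eval_X] at h1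
    rw [intervalIntegral.integral_sub (by apply Continuous.intervalIntegrable; fun_prop)
      (by apply Continuous.intervalIntegrable; fun_prop), intervalIntegral.integral_const_mul,
      intervalIntegral.integral_const_mul, ih] at h1
    norm_num at h1
    have h3 : (2 * (m : ℝ) + 3) ≠ 0 := by positivity
    have h4 : ((2 * m + 1).factorial : ℝ) ≠ 0 := by positivity
    have h5 : (2 * (m : ℝ) + 3) * ∫ x in (-1 : ℝ)..1, (1 - x ^ 2) ^ (m + 1) =
      (2 * m + 2) * (2 * 4 ^ m * (m.factorial : ℝ) ^ 2 / ((2 * m + 1).factorial : ℝ)) := by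
      linarith
    rw [show 2 * (m + 1) + 1 = 2 * m + 1 + 1 + 1 by ring, Nat.factorial_succ m,
      Nat.factorial_succ (2 * m + 1 + 1), Nat.factorial_succ (2 * m + 1)]
    push_cast
    rw [← mul_right_inj' h3, h5]
    field_simp
    ring

/-- Variation of constants for a three-term recurrence: `p` and `q` solve the unperturbed
recurrence with Casoratian `1`, and `g` solves the perturbed one. -/
theorem variation_of_constants {c a d p q g : ℕ → ℝ} (hc0 : c 0 = 0) (hc : ∀ n, c (n + 1) ≠ 0)
    (hp0 : p 0 ≠ 0) (hg0 : g 0 = p 0)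
    (hp : ∀ n, c (n + 1) * p (n + 1) = a n * p n - c n * p (n - 1))
    (hq : ∀ n, c (n + 1) * q (n + 1) = a n * q n - c n * q (n - 1) - if n = 0 then 1 / p 0 else 0)
    (hg : ∀ n, c (n + 1) * g (n + 1) = (a n - d n) * g n - c n * g (n - 1)) (n : ℕ) :
    g n = p n * (1 - ∑ k ∈ Finset.range n, d k * g k * q k) +
      q n * ∑ k ∈ Finset.range n, d k * g k * p k := by
  have hW : ∀ n, c (n + 1) * (q n * p (n + 1) - p n * q (n + 1)) = 1 := by
    intro n
    induction n with
    | zero =>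
      have h1 := hp 0
      have h2 := hq 0
      rw [hc0] at h1 h2
      simp only [if_true] at h2
      have h3 : p 0 * (1 / p 0) = 1 := by field_simp
      linear_combination q 0 * h1 - p 0 * h2 + h3
    | succ n ih =>
      have h1 := hp (n + 1)
      have h2 := hq (n + 1)
      simp only [Nat.succ_ne_zero, if_false, Nat.add_sub_cancel] at h1 h2
      linear_combination q (n + 1) * h1 - p (n + 1) * h2 + ih
  induction n using Nat.strong_induction_on with
  | _ n ih =>
    match n with
    | 0 => simp [hg0]
    | 1 =>
      apply mul_left_cancel₀ (hc 0)
      have h1 := hp 0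
      have h2 := hq 0
      have h3 := hg 0
      have hw := hW 0
      rw [hc0] at h1 h2 h3
      simp only [Finset.sum_range_one, zero_add] at *
      rw [hg0] at *
      linear_combination h3 - h1 + d 0 * p 0 * hw
    | n + 2 =>
      apply mul_left_cancel₀ (hc (n + 1))
      have h1 := hp (n + 1)
      have h2 := hq (n + 1)
      have h3 := hg (n + 1)
      have hw := hW n
      have i1 := ih (n + 1) (by omega)
      have i0 := ih n (by omega)
      simp only [Nat.succ_ne_zero, if_false, Nat.add_sub_cancel] at h1 h2 h3
      simp only [Finset.sum_range_succ] at i1 i0 ⊢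
      set A := ∑ k ∈ Finset.range n, d k * g k * q k
      set B := ∑ k ∈ Finset.range n, d k * g k * p k
      linear_combination h3 - (1 - (A + d n * g n * q n + d (n + 1) * g (n + 1) * q (n + 1))) * h1 -
        (B + d n * g n * p n + d (n + 1) * g (n + 1) * p (n + 1)) * h2 + a (n + 1) * i1 -
        c (n + 1) * i0 + d (n + 1) * g (n + 1) * hw

section NormalizedRecurrences

variable (m n : ℕ)

/-- The off-diagonal coefficient `√((m+n)² − m²)`. -/
noncomputable def offDiag (m n : ℕ) : ℝ := √(((m + n : ℕ) : ℝ) ^ 2 - (m : ℝ) ^ 2)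

theorem offDiag_zero : offDiag m 0 = 0 := by simp [offDiag]

theorem offDiag_eq : offDiag m n = √((n : ℝ) * (2 * m + n)) := by
  rw [offDiag]; congr 1; push_cast; ring

theorem offDiag_succ_ne_zero : offDiag m (n + 1) ≠ 0 := by
  rw [offDiag_eq]
  positivity

theorem offDiag_succ_mul_sqrt_succ :
    offDiag m (n + 1) * √(((n + 1).factorial : ℝ) / ((2 * m + n + 1).factorial : ℝ)) =
      (n + 1) * √((n.factorial : ℝ) / ((2 * m + n).factorial : ℝ)) := by
  rw [offDiag_eq, ← Real.sqrt_mul (by positivity),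
    ← Real.sqrt_sq (show (0 : ℝ) ≤ n + 1 by positivity), ← Real.sqrt_mul (by positivity)]
  congr 1
  rw [Nat.factorial_succ, Nat.factorial_succ]
  push_cast
  field_simp
  ring

theorem offDiag_succ_mul_sqrt :
    offDiag m (n + 1) * √((n.factorial : ℝ) / ((2 * m + n).factorial : ℝ)) =
      (2 * m + n + 1) * √(((n + 1).factorial : ℝ) / ((2 * m + n + 1).factorial : ℝ)) := by
  rw [offDiag_eq, ← Real.sqrt_mul (by positivity),
    ← Real.sqrt_sq (show (0 : ℝ) ≤ 2 * m + n + 1 by positivity), ← Real.sqrt_mul (by positivity)]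
  congr 1
  rw [Nat.factorial_succ, Nat.factorial_succ]
  push_cast
  field_simp
  ring

theorem pml_add (x : ℝ) : pml m (m + n) x =
    √((n.factorial : ℝ) / ((2 * m + n).factorial : ℝ)) * (legendreDeriv m (m + n)).eval x := by
  rw [pml, iteratedDeriv_legendreP, Nat.add_sub_cancel_left, show m + n + m = 2 * m + n by ring]

theorem pml_recurrence (x : ℝ) :
    offDiag m (n + 1) * pml m (m + (n + 1)) x =
      (2 * ((m + n : ℕ) : ℝ) + 1) * x * pml m (m + n) x -
        offDiag m n * pml m (m + (n - 1)) x := by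
  cases n with
  | zero =>
    rw [offDiag_zero, pml_add, pml_add, ← mul_assoc, zero_add]
    have h := congrArg (Polynomial.eval x) (legendreDeriv_succ_self m)
    simp only [Polynomial.eval_mul, Polynomial.eval_C, Polynomial.eval_X] at h
    have h1 := offDiag_succ_mul_sqrt_succ m 0
    simp only [zero_add, Nat.cast_zero, add_zero] at h1 ⊢
    rw [h1, h]
    ring
  | succ n =>
    rw [pml_add, pml_add, Nat.add_sub_cancel, pml_add]
    have h := congrArg (Polynomial.eval x) (legendreDeriv_recurrence m (m + n))
    simp only [Polynomial.eval_mul, Polynomial.eval_C, Polynomial.eval_X,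
      Polynomial.eval_sub] at h
    have h1 := offDiag_succ_mul_sqrt_succ m (n + 1)
    have h2 := offDiag_succ_mul_sqrt m n
    push_cast at h h1 h2 ⊢
    simp only [← add_assoc] at h h1 h2 ⊢
    linear_combination (Polynomial.eval x (legendreDeriv m (m + n + 1 + 1))) * h1 +
      (Polynomial.eval x (legendreDeriv m (m + n))) * h2 +
      √(((n + 1).factorial : ℝ) / ((2 * m + n + 1).factorial : ℝ)) * h

theorem pml_self (x : ℝ) : pml m m x =
    √((2 * m).factorial : ℝ) / (2 ^ m * (m.factorial : ℝ)) := by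
  have h := pml_add m 0 x
  rw [add_zero, legendreDeriv_self, Polynomial.eval_C] at h
  rw [h, add_zero, Nat.factorial_zero, Nat.cast_one, Real.sqrt_div zero_le_one, Real.sqrt_one]
  have h0 : √((2 * m).factorial : ℝ) ≠ 0 := by positivity
  have h1 : √((2 * m).factorial : ℝ) ^ 2 = ((2 * m).factorial : ℝ) := Real.sq_sqrt (by positivity)
  field_simp
  linear_combination -h1

theorem continuous_pml : Continuous (pml m (m + n)) := by
  rw [show pml m (m + n) = _ from funext (pml_add m n)]
  fun_prop

theorem integral_pml :
    (2 * ((m + n : ℕ) : ℝ) + 1) / 2 * ∫ x in (-1 : ℝ)..1, pml m (m + n) x * (1 - x ^ 2) ^ m =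
      if n = 0 then 1 / pml m m 0 else 0 := by
  split_ifs with h
  · subst h
    simp only [add_zero, pml_self]
    rw [intervalIntegral.integral_const_mul, integral_one_sub_sq_pow, Nat.factorial_succ]
    have h0 : √((2 * m).factorial : ℝ) ≠ 0 := by positivity
    have h1 : √((2 * m).factorial : ℝ) ^ 2 = ((2 * m).factorial : ℝ) :=
      Real.sq_sqrt (by positivity)
    push_cast
    rw [show (4 : ℝ) = 2 ^ 2 by norm_num, ← pow_mul]
    field_simp
    rw [h1]
    ring
  · have h0 := integral_legendreDeriv_eq_zero (m := m) (l := m + n) (by omega)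
    simp only [pml_add, mul_assoc, intervalIntegral.integral_const_mul, h0, mul_zero]

variable {ν : ℝ}

theorem sub_ne_zero_of_one_lt_abs (hν : 1 < |ν|) {x : ℝ} (hx : x ∈ Set.uIcc (-1 : ℝ) 1) :
    ν - x ≠ 0 := by
  rw [Set.uIcc_of_le (by norm_num)] at hx
  intro h
  rw [sub_eq_zero.mp h] at hν
  exact absurd (abs_le.mpr hx) (not_le.mpr hν)

theorem intervalIntegrable_pml_div (hν : 1 < |ν|) :
    IntervalIntegrable (fun x => pml m (m + n) x / (ν - x) * (1 - x ^ 2) ^ m) volume (-1) 1 := by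
  apply ContinuousOn.intervalIntegrable
  refine ContinuousOn.mul (ContinuousOn.div (continuous_pml m n).continuousOn (by fun_prop)
    fun x hx => sub_ne_zero_of_one_lt_abs hν hx) (by fun_prop)

theorem qml_recurrence (hν : 1 < |ν|) :
    offDiag m (n + 1) * qml m (m + (n + 1)) ν =
      (2 * ((m + n : ℕ) : ℝ) + 1) * ν * qml m (m + n) ν -
        offDiag m n * qml m (m + (n - 1)) ν - if n = 0 then 1 / pml m m ν else 0 := by
  have hconst : pml m m ν = pml m m 0 := by rw [pml_self, pml_self]
  rw [hconst, ← integral_pml m n, qml, qml, qml]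
  have h : ∫ x in (-1 : ℝ)..1,
      (offDiag m (n + 1) * (pml m (m + (n + 1)) x / (ν - x) * (1 - x ^ 2) ^ m) +
        offDiag m n * (pml m (m + (n - 1)) x / (ν - x) * (1 - x ^ 2) ^ m)) =
      ∫ x in (-1 : ℝ)..1,
      ((2 * ((m + n : ℕ) : ℝ) + 1) * ν * (pml m (m + n) x / (ν - x) * (1 - x ^ 2) ^ m) -
        (2 * ((m + n : ℕ) : ℝ) + 1) * (pml m (m + n) x * (1 - x ^ 2) ^ m)) := by
    refine intervalIntegral.integral_congr fun x hx => ?_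
    have hx' := sub_ne_zero_of_one_lt_abs hν hx
    have hr := pml_recurrence m n x
    field_simp
    linear_combination (1 - x ^ 2) ^ m * hr
  rw [intervalIntegral.integral_add ((intervalIntegrable_pml_div m _ hν).const_mul _)
      ((intervalIntegrable_pml_div m _ hν).const_mul _),
    intervalIntegral.integral_sub ((intervalIntegrable_pml_div m _ hν).const_mul _)
      (by
        apply Continuous.intervalIntegrable
        have := continuous_pml m n
        fun_prop)] at h
  simp only [intervalIntegral.integral_const_mul] at h
  linear_combination (1 / 2) * h

theorem chandraAux_recurrence (ϖ : ℝ) (β : ℕ → ℝ) (L : ℕ) (ν : ℝ) :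
    offDiag m (n + 1) * chandraAux ϖ β L m ν (n + 1) =
      ν * hcoef ϖ β L (m + n) * chandraAux ϖ β L m ν n -
        offDiag m n * chandraAux ϖ β L m ν (n - 1) := by
  have h := offDiag_succ_ne_zero m n
  cases n with
  | zero =>
    rw [offDiag_zero, zero_mul, sub_zero]
    simp only [zero_add, add_zero, chandraAux, offDiag] at h ⊢
    push_cast at h ⊢
    field_simp
  | succ n =>
    simp only [chandraAux, offDiag, ← add_assoc, Nat.add_sub_cancel] at h ⊢
    field_simp

end NormalizedRecurrences

/-- for `l ≥ L+1` and `|ν| > 1`,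
`p_l^m(ν) Λ^m(ν) = g_l^m(ν) − ϖ ν g^m(ν,ν) q_l^m(ν)`. -/
theorem stmt_5 (L : ℕ) (hL : 1 ≤ L) (ϖ : ℝ) (hϖ : ϖ ∈ Set.Ioo (0 : ℝ) 1)
    (β : ℕ → ℝ) (hβ0 : β 0 = 1)
    (hβ : ∀ l : ℕ, 1 ≤ l → l ≤ L → β l ∈ Set.Ioo (0 : ℝ) (2 * (l : ℝ) + 1))
    (m : ℕ) (hm : m ≤ L)
    (l : ℕ) (hl : L + 1 ≤ l) (ν : ℝ) (hν : 1 < |ν|) :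
    pml m l ν * Lam ϖ β L m ν =
      gml ϖ β L m l ν - ϖ * ν * gfun ϖ β L m ν ν * qml m l ν := by
  obtain ⟨N, rfl⟩ : ∃ N, l = m + N := ⟨l - m, by omega⟩
  set d : ℕ → ℝ := fun k => if m + k ≤ L then ϖ * ν * β (m + k) else 0 with hd
  have hgml : ∀ k, gml ϖ β L m (m + k) ν = chandraAux ϖ β L m ν k := fun k => by simp [gml]
  have hp0 : pml m m ν ≠ 0 := by rw [pml_self]; positivity
  have key := variation_of_constants (c := offDiag m)
    (a := fun k => (2 * ((m + k : ℕ) : ℝ) + 1) * ν) (d := d)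
    (p := fun k => pml m (m + k) ν) (q := fun k => qml m (m + k) ν)
    (g := fun k => gml ϖ β L m (m + k) ν)
    (offDiag_zero m) (offDiag_succ_ne_zero m) hp0
    (by rw [hgml, add_zero, pml_self, chandraAux])
    (fun k => pml_recurrence m k ν) (fun k => qml_recurrence m k hν)
    (fun k => by
      simp only [hgml, chandraAux_recurrence, hd, hcoef]
      split_ifs <;> push_cast <;> ring) N
  have hsum : ∀ f : ℕ → ℝ,
      ∑ k ∈ Finset.range N, d k * gml ϖ β L m (m + k) ν * f (m + k) =
        ϖ * ν * ∑ k ∈ Finset.Icc m L, β k * f k * gml ϖ β L m k ν := by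
    intro f
    have hsub : Finset.range (L + 1 - m) ⊆ Finset.range N :=
      Finset.range_subset_range.mpr (by omega)
    rw [← Finset.sum_subset hsub, ← Finset.Ico_add_one_right_eq_Icc, Finset.sum_Ico_eq_sum_range,
      Finset.mul_sum]
    · refine Finset.sum_congr rfl fun k hk => ?_
      have hk' : m + k ≤ L := by have := Finset.mem_range.mp hk; omega
      simp only [hd, if_pos hk']
      ring
    · intro k _ hk
      have hk' : ¬ m + k ≤ L := by have := mt Finset.mem_range.mpr hk; omega
      simp only [hd, if_neg hk', zero_mul]
  have hLam : Lam ϖ β L m ν =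
      1 - ϖ * ν * ∑ k ∈ Finset.Icc m L, β k * qml m k ν * gml ϖ β L m k ν := by
    have hint : ∫ x in (-1 : ℝ)..1, gfun ϖ β L m ν x / (ν - x) * (1 - x ^ 2) ^ m =
        ∑ k ∈ Finset.Icc m L, β k * gml ϖ β L m k ν *
          ∫ x in (-1 : ℝ)..1, pml m k x / (ν - x) * (1 - x ^ 2) ^ m := by
      simp only [← intervalIntegral.integral_const_mul]
      rw [← intervalIntegral.integral_finsetSum]
      · congr 1
        funext x
        rw [gfun, Finset.sum_div, Finset.sum_mul]
        exact Finset.sum_congr rfl fun k _ => by ring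
      · intro k hk
        obtain ⟨j, rfl⟩ := Nat.exists_eq_add_of_le (Finset.mem_Icc.mp hk).1
        exact (intervalIntegrable_pml_div m j hν).const_mul _
    rw [Lam, hint, Finset.mul_sum, Finset.mul_sum]
    congr 1
    refine Finset.sum_congr rfl fun k _ => ?_
    rw [qml]
    ring
  rw [hsum (fun k => qml m k ν), hsum (fun k => pml m k ν), ← hLam] at key
  rw [key, gfun]
  ring
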